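/- Let α = (a_1, ..., a_n) be a zero-sum-free sequence of elements of an abelian group with |Σ(α)| < 2n. If |Σ(α_m)| ≥ 2m for some m ∈ [1, n−1], then the terms a_{m+1}, ..., a_n of α can be permuted (while keeping the order of the first m terms) so that the resulting sequence is sharp. -/

import Mathlib

/-- The set of all subsequence sums of a list (including the sum 0 of the empty
subsequence). -/
def subSums {G : Type*} [AddCommMonoid G] [DecidableEq G] (l : List G) : Finset G :=
  (l.sublists.map List.sum).toFinset

/-- A sequence is zero-sum-free if no nonempty subsequence sums to zero. -/
def ZeroSumFree {G : Type*} [AddCommMonoid G] (l : List G) : Prop :=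
  ∀ t : List G, t.Sublist l → t ≠ [] → t.sum ≠ 0

/-- A sequence `α` of length `n` is sharp if `Σ(α) = Σ(α_{n-1}) ∪ {σ(α)}`. -/
def IsSharp {G : Type*} [AddCommMonoid G] [DecidableEq G] (l : List G) : Prop :=
  subSums l = subSums l.dropLast ∪ {l.sum}

theorem mem_subSums {G : Type*} [AddCommMonoid G] [DecidableEq G] {l : List G} {g : G} :
    g ∈ subSums l ↔ ∃ s : List G, s.Subperm l ∧ s.sum = g := by
  simp only [subSums, List.mem_toFinset, List.mem_map, List.mem_sublists]
  constructor
  · rintro ⟨s, hs, rfl⟩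
    exact ⟨s, hs.subperm, rfl⟩
  · rintro ⟨s, ⟨t, hts, htl⟩, rfl⟩
    exact ⟨t, htl, hts.sum_eq⟩

theorem subSums_perm {G : Type*} [AddCommMonoid G] [DecidableEq G] {l l' : List G}
    (h : l.Perm l') : subSums l = subSums l' := by
  ext g
  simp only [mem_subSums, h.subperm_left]

theorem subSums_concat {G : Type*} [AddCommMonoid G] [DecidableEq G] (l : List G) (x : G) :
    subSums (l ++ [x]) = subSums l ∪ (subSums l).image (· + x) := by
  ext g
  simp only [subSums, List.sublists_concat, List.map_append, List.toFinset_append,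
    Finset.mem_union, List.mem_toFinset, List.mem_map, Finset.mem_image]
  simp

theorem sum_mem_subSums {G : Type*} [AddCommMonoid G] [DecidableEq G] (l : List G) :
    l.sum ∈ subSums l :=
  mem_subSums.2 ⟨l, List.Subperm.refl l, rfl⟩

theorem zero_mem_subSums {G : Type*} [AddCommMonoid G] [DecidableEq G] (l : List G) :
    (0 : G) ∈ subSums l :=
  mem_subSums.2 ⟨[], List.nil_subperm, rfl⟩

theorem ZeroSumFree.sum_ne_zero {G : Type*} [AddCommMonoid G] {l s : List G}
    (h : ZeroSumFree l) (hs : s.Subperm l) (hne : s ≠ []) : s.sum ≠ 0 := by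
  obtain ⟨t, hts, htl⟩ := hs
  rw [← hts.sum_eq]
  refine h t htl ?_
  rintro rfl
  exact hne (List.nil_perm.1 hts)

theorem ZeroSumFree.of_subperm {G : Type*} [AddCommMonoid G] {l l' : List G}
    (h : ZeroSumFree l) (hl : l'.Subperm l) : ZeroSumFree l' :=
  fun _ ht hne => h.sum_ne_zero (ht.subperm.trans hl) hne

theorem ZeroSumFree.add_ne_zero {G : Type*} [AddCommMonoid G] [DecidableEq G] {l : List G}
    {x a : G} (h : ZeroSumFree (l ++ [x])) (ha : a ∈ subSums l) : a + x ≠ 0 := by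
  obtain ⟨s, hs, rfl⟩ := mem_subSums.1 ha
  have := h.sum_ne_zero (s := s ++ [x]) ((List.subperm_append_right [x]).2 hs) (by simp)
  simpa using this

theorem ZeroSumFree.sum_add_notMem {G : Type*} [AddCommGroup G] [DecidableEq G] {l : List G}
    {x : G} (h : ZeroSumFree (l ++ [x])) : l.sum + x ∉ subSums l := by
  intro hmem
  obtain ⟨s, hs, hsum⟩ := mem_subSums.1 hmem
  have hp := List.subperm_append_diff_self_of_count_le (List.subperm_ext_iff.1 hs)
  refine h.add_ne_zero (mem_subSums.2 ⟨l.diff s, (List.diff_sublist l s).subperm, rfl⟩) ?_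
  have hl : s.sum + (l.diff s).sum = l.sum := by rw [← List.sum_append, hp.sum_eq]
  rw [hsum, add_assoc] at hl
  rw [add_comm]
  exact add_eq_left.1 hl

theorem isSharp_concat_iff {G : Type*} [AddCommMonoid G] [DecidableEq G] {l : List G} {x : G} :
    IsSharp (l ++ [x]) ↔ ∀ a ∈ subSums l, a + x ∈ subSums l ∨ a + x = l.sum + x := by
  simp only [IsSharp, subSums_concat, List.dropLast_concat, List.sum_append, List.sum_singleton]
  constructor
  · intro h a ha
    have : a + x ∈ subSums l ∪ {l.sum + x} :=
      h ▸ Finset.mem_union_right _ (Finset.mem_image_of_mem _ ha)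
    simpa [or_comm] using this
  · intro h
    ext g
    simp only [Finset.mem_union, Finset.mem_image, Finset.mem_singleton]
    constructor
    · rintro (hg | ⟨a, ha, rfl⟩)
      · exact Or.inl hg
      · exact h a ha
    · rintro (hg | rfl)
      · exact Or.inl hg
      · exact Or.inr ⟨_, sum_mem_subSums l, rfl⟩

theorem isSharp_concat_of_card_le {G : Type*} [AddCommGroup G] [DecidableEq G] {l : List G}
    {x : G} (h : ZeroSumFree (l ++ [x]))
    (hcard : (subSums (l ++ [x])).card ≤ (subSums l).card + 1) : IsSharp (l ++ [x]) := by
  rw [IsSharp, List.dropLast_concat, List.sum_append, List.sum_singleton]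
  symm
  apply Finset.eq_of_subset_of_card_le
  · rw [subSums_concat]
    refine Finset.union_subset_union_right (Finset.singleton_subset_iff.2 ?_)
    exact Finset.mem_image_of_mem _ (sum_mem_subSums l)
  · rwa [Finset.union_singleton, Finset.card_insert_of_notMem h.sum_add_notMem]

/-- Appending a sharp term repeatedly keeps the sequence sharp. -/
theorem IsSharp.append_replicate {G : Type*} [AddCommMonoid G] [DecidableEq G] {l : List G}
    {x : G} (h : IsSharp (l ++ [x])) (k : ℕ) :
    IsSharp (l ++ List.replicate k x ++ [x]) := by
  induction k with
  | zero => simpa using h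
  | succ k ih =>
    rw [List.replicate_succ', ← List.append_assoc, isSharp_concat_iff]
    set q := l ++ List.replicate k x
    intro a ha
    have hq : subSums (q ++ [x]) = subSums q ∪ {q.sum + x} := by
      simpa [IsSharp] using ih
    have hqs : (q ++ [x]).sum = q.sum + x := by simp
    rw [hq, Finset.mem_union, Finset.mem_singleton] at ha
    rcases ha with ha | rfl
    · left
      rw [subSums_concat]
      exact Finset.mem_union_right _ (Finset.mem_image_of_mem _ ha)
    · right
      rw [hqs]

/-- A nonempty sequence has at most one sharp zero-sum-free one-term extension. -/
theorem IsSharp.eq_of_concat {G : Type*} [AddCommGroup G] [DecidableEq G] {l : List G}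
    {x y : G} (hl : l ≠ []) (hx : ZeroSumFree (l ++ [x])) (hy : ZeroSumFree (l ++ [y]))
    (hsx : IsSharp (l ++ [x])) (hsy : IsSharp (l ++ [y])) : x = y := by
  have hl0 : l.sum ≠ 0 := hx.sum_ne_zero (List.sublist_append_left l [x]).subperm hl
  have hy0 : y ≠ 0 := by simpa using hy.add_ne_zero (zero_mem_subSums l)
  rw [isSharp_concat_iff] at hsx hsy
  have himage : (subSums l).image (· + y) = insert (l.sum + y) ((subSums l).erase 0) := by
    apply Finset.eq_of_subset_of_card_le
    · intro g hg
      obtain ⟨a, ha, rfl⟩ := Finset.mem_image.1 hg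
      have := hy.add_ne_zero ha
      rcases hsy a ha with h | h <;> simp_all
    · rw [Finset.card_image_of_injective _ (add_left_injective y)]
      refine (Finset.card_insert_le _ _).trans ?_
      rw [Finset.card_erase_add_one (zero_mem_subSums l)]
  have hmem : l.sum ∈ (subSums l).image (· + y) := by
    rw [himage]
    exact Finset.mem_insert_of_mem (Finset.mem_erase.2 ⟨hl0, sum_mem_subSums l⟩)
  obtain ⟨a, ha, hay⟩ := Finset.mem_image.1 hmem
  have hax : a + x ∈ subSums l := by
    refine (hsx a ha).resolve_right fun h => hy0 ?_
    rw [← add_right_cancel h] at hay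
    exact add_eq_left.1 hay
  rcases hsy _ hax with h | h
  · rw [add_right_comm, hay] at h
    exact absurd h hx.sum_add_notMem
  · rw [add_right_comm, hay] at h
    exact add_left_cancel h

theorem exists_perm_isSharp_append {G : Type*} [AddCommGroup G] [DecidableEq G] (n : ℕ) :
    ∀ p t : List G, t.length = n → p ≠ [] → t ≠ [] → ZeroSumFree (p ++ t) →
      (subSums (p ++ t)).card < 2 * (p.length + t.length) →
      2 * p.length ≤ (subSums p).card →
      ∃ t' : List G, t.Perm t' ∧ IsSharp (p ++ t') := by
  induction n with
  | zero =>
    intro p t hn _ ht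
    exact absurd (List.length_eq_zero_iff.1 hn) ht
  | succ n ih =>
    intro p t hn hp ht hzsf hcard hbig
    by_cases hex : ∃ y ∈ t, 2 * (p.length + 1) ≤ (subSums (p ++ [y])).card
    · obtain ⟨y, hy, hybig⟩ := hex
      have hperm := List.perm_cons_erase hy
      set r := t.erase y
      have hlen : t.length = r.length + 1 := by simpa using hperm.length_eq
      have happ : (p ++ t).Perm (p ++ [y] ++ r) := by simpa using hperm.append_left p
      have hcard' : (subSums (p ++ [y] ++ r)).card < 2 * ((p ++ [y]).length + r.length) := by
        rw [← subSums_perm happ, List.length_append, List.length_singleton]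
        omega
      have hr : r ≠ [] := by
        intro hr
        simp only [hr, List.append_nil, List.length_append, List.length_singleton,
          List.length_nil] at hcard'
        omega
      obtain ⟨t', ht', hsharp⟩ := ih (p ++ [y]) r (by omega) (by simp) hr
        (hzsf.of_subperm happ.symm.subperm) hcard' (by simpa using hybig)
      exact ⟨y :: t', hperm.trans (ht'.cons y), by simpa using hsharp⟩
    · push Not at hex
      have hz : ∀ y ∈ t, ZeroSumFree (p ++ [y]) := fun y hy =>
        hzsf.of_subperm ((List.singleton_sublist.2 hy).append_left p).subperm
      have hs : ∀ y ∈ t, IsSharp (p ++ [y]) := fun y hy =>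
        isSharp_concat_of_card_le (hz y hy) (by have := hex y hy; omega)
      obtain ⟨x, hx⟩ := List.exists_mem_of_ne_nil t ht
      have hrep : t = List.replicate (n + 1) x := List.eq_replicate_iff.2
        ⟨hn, fun y hy => IsSharp.eq_of_concat hp (hz y hy) (hz x hx) (hs y hy) (hs x hx)⟩
      refine ⟨t, List.Perm.refl t, ?_⟩
      rw [hrep, List.replicate_succ', ← List.append_assoc]
      exact (hs x hx).append_replicate n

/-- **Claim.** Let `α` be a zero-sum-free sequence of length `n` with `|Σ(α)| < 2n`.
If `|Σ(α_m)| ≥ 2m` for some `m ∈ [1, n−1]`, then the terms `a_{m+1}, ..., a_n` can be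
permuted (keeping the order of the first `m` terms) so that the resulting sequence is
sharp. -/
theorem sharp_rearrangement {G : Type*} [AddCommGroup G] [DecidableEq G]
    (l : List G) (hzsf : ZeroSumFree l) (hcard : (subSums l).card < 2 * l.length)
    (m : ℕ) (hm1 : 1 ≤ m) (hm2 : m < l.length)
    (hbig : 2 * m ≤ (subSums (l.take m)).card) :
    ∃ l₂ : List G, (l.drop m).Perm l₂ ∧ IsSharp (l.take m ++ l₂) := by
  have htake : (l.take m).length = m := List.length_take_of_le hm2.le
  have hdrop : (l.drop m).length = l.length - m := List.length_drop
  refine exists_perm_isSharp_append _ (l.take m) (l.drop m) rfl ?_ ?_ ?_ ?_ ?_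
  · exact List.ne_nil_of_length_pos (by omega)
  · exact List.ne_nil_of_length_pos (by omega)
  · rwa [List.take_append_drop]
  · rw [List.take_append_drop]
    omega
  · rwa [htake]
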